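/- Let p be a prime number with p ≡ 1 (mod 3). Then there exist integers X and Y such that p = X² + 3Y². -/

import Mathlib

/-- **Thue's lemma**: every residue modulo `n` is a quotient of two integers of absolute value
at most `√n`. -/
theorem exists_small_eq_mul_of_zmod (n : ℕ) [NeZero n] (a : ZMod n) :
    ∃ x y : ℤ, (x ≠ 0 ∨ y ≠ 0) ∧ x ^ 2 ≤ n ∧ y ^ 2 ≤ n ∧ (x : ZMod n) = a * y := by
  set s := n.sqrt
  have hcard : Fintype.card (ZMod n) < Fintype.card (Fin (s + 1) × Fin (s + 1)) := by
    simpa [ZMod.card] using Nat.lt_succ_sqrt n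
  obtain ⟨⟨x₁, y₁⟩, ⟨x₂, y₂⟩, hne, heq⟩ := Fintype.exists_ne_map_eq_of_card_lt
    (fun u : Fin (s + 1) × Fin (s + 1) ↦ ((u.1 : ℕ) : ZMod n) - a * ((u.2 : ℕ) : ZMod n)) hcard
  have hs : (s : ℤ) ^ 2 ≤ n := by exact_mod_cast Nat.sqrt_le' n
  have hsmall (u v : Fin (s + 1)) : ((u : ℤ) - (v : ℤ)) ^ 2 ≤ n :=
    (sq_le_sq' (by omega) (by omega)).trans hs
  refine ⟨(x₁ : ℤ) - x₂, (y₁ : ℤ) - y₂, ?_, hsmall x₁ x₂, hsmall y₁ y₂, ?_⟩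
  · contrapose! hne
    ext <;> simp only <;> omega
  · push_cast
    linear_combination heq

theorem ZMod.isSquare_neg_three {p : ℕ} [Fact p.Prime] (h : p % 3 = 1) :
    IsSquare (-3 : ZMod p) := by
  have hdvd : 3 ∣ Fintype.card (ZMod p)ˣ := by
    rw [ZMod.card_units]
    omega
  obtain ⟨w, hw⟩ := exists_prime_orderOf_dvd_card 3 hdvd
  have hw' : IsPrimitiveRoot (w : ZMod p) 3 := by
    rw [IsPrimitiveRoot.coe_units_iff, ← hw]
    exact IsPrimitiveRoot.orderOf w
  have hsum := hw'.geom_sum_eq_zero (by norm_num)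
  simp only [Finset.sum_range_succ, Finset.sum_range_zero] at hsum
  exact ⟨2 * w + 1, by linear_combination -4 * hsum⟩

theorem fermat_x2_3y2 (p : ℕ) (hp : p.Prime) (h : p % 3 = 1) :
    ∃ X Y : ℤ, (p : ℤ) = X ^ 2 + 3 * Y ^ 2 := by
  have : Fact p.Prime := ⟨hp⟩
  obtain ⟨a, ha⟩ := ZMod.isSquare_neg_three h
  obtain ⟨x, y, hne, hx, hy, hxy⟩ := exists_small_eq_mul_of_zmod p a
  have hlt {z : ℤ} (hz : z ^ 2 ≤ p) : z ^ 2 < p :=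
    lt_of_le_of_ne hz fun e ↦
      (Nat.prime_iff_prime_int.mp hp).not_isSquare ⟨z, by rw [← e, sq]⟩
  have hdvd : (p : ℤ) ∣ x ^ 2 + 3 * y ^ 2 := by
    rw [← ZMod.intCast_zmod_eq_zero_iff_dvd]
    push_cast
    rw [hxy]
    linear_combination -(y : ZMod p) ^ 2 * ha
  obtain ⟨k, hk⟩ := hdvd
  have hp0 : (0 : ℤ) < p := by exact_mod_cast hp.pos
  have hpos : 0 < x ^ 2 + 3 * y ^ 2 := by
    rcases hne with h0 | h0 <;> positivity
  have hk0 : 0 < k := pos_of_mul_pos_right (hk ▸ hpos) hp0.le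
  have hk4 : k < 4 := by nlinarith [hlt hx, hlt hy]
  interval_cases k
  · exact ⟨x, y, by linarith⟩
  · have hodd : p % 2 = 1 := hp.eq_two_or_odd.resolve_left (by rintro rfl; omega)
    rcases Int.even_or_odd' x with ⟨b, rfl | rfl⟩ <;>
      rcases Int.even_or_odd' y with ⟨c, rfl | rfl⟩ <;> ring_nf at hk <;> omega
  · obtain ⟨z, rfl⟩ : (3 : ℤ) ∣ x :=
      Int.prime_three.dvd_of_dvd_pow (n := 2) ⟨p - y ^ 2, by linarith⟩
    exact ⟨y, z, by linarith⟩
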